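/- Under the stated hypotheses, ẋ ∈ L²([0,∞); H), i.e., ∫_0^∞ ‖ẋ(t)‖² dt < +∞. -/

import Mathlib

open Filter MeasureTheory Set RealInnerProductSpace

section

variable {H : Type*} [NormedAddCommGroup H] [InnerProductSpace ℝ H] [CompleteSpace H]

/-- A differentiable function composed with a curve is differentiated by pairing the gradient with
the velocity. -/
theorem HasGradientAt.comp_hasDerivWithinAt {f : H → ℝ} {g : H} {x : ℝ → H} {v : H} {s : Set ℝ}
    {t : ℝ} (hf : HasGradientAt f g (x t)) (hx : HasDerivWithinAt x v s t) :
    HasDerivWithinAt (fun r => f (x r)) ⟪g, v⟫ s t := by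
  simpa [Function.comp_def] using hf.hasFDerivAt.comp_hasDerivWithinAt t hx

/-- A differentiable convex function lies above its tangent hyperplanes. -/
theorem ConvexOn.add_inner_gradient_le {f : H → ℝ} (hf : ConvexOn ℝ univ f)
    (hd : Differentiable ℝ f) (y w : H) : f y + ⟪gradient f y, w - y⟫ ≤ f w := by
  have hline : ConvexOn ℝ univ (f ∘ AffineMap.lineMap (k := ℝ) y w) := by
    simpa using hf.comp_affineMap (AffineMap.lineMap (k := ℝ) y w)
  have hx : HasDerivWithinAt (AffineMap.lineMap (k := ℝ) y w) (w - y) univ (0 : ℝ) :=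
    AffineMap.hasDerivWithinAt_lineMap
  have hg : HasGradientAt f (gradient f y) (AffineMap.lineMap (k := ℝ) y w (0 : ℝ)) := by
    simpa using (hd y).hasGradientAt
  have h := hline.le_slope_of_hasDerivWithinAt (mem_univ 0) (mem_univ 1) one_pos
    (hg.comp_hasDerivWithinAt hx)
  simp only [slope_def_field, Function.comp_apply, AffineMap.lineMap_apply_zero,
    AffineMap.lineMap_apply_one, sub_zero, div_one] at h
  linarith

/-- First-order optimality: at a minimizer over a convex set, the gradient pairs nonnegatively with
feasible directions. -/
theorem IsMinOn.inner_gradient_nonneg {f : H → ℝ} {s : Set H} {z y : H} (h : IsMinOn f s z)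
    (hs : Convex ℝ s) (hd : DifferentiableAt ℝ f z) (hz : z ∈ s) (hy : y ∈ s) :
    0 ≤ ⟪gradient f z, y - z⟫ := by
  simpa using h.localize.hasFDerivWithinAt_nonneg
    hd.hasGradientAt.hasFDerivAt.hasFDerivWithinAt
    (sub_mem_posTangentConeAt_of_segment_subset (hs.segment_subset hz hy))

end

/-- If a continuous function on `[0, ∞)` is dominated by a function of finite integral, then its
integrals over `[0, T]` are bounded above uniformly in `T`. -/
theorem intervalIntegral_le_toReal_lintegral {f : ℝ → ℝ} {g : ℝ → ENNReal}
    (hf : ContinuousOn f (Ici 0)) (hfg : ∀ t ∈ Ici (0 : ℝ), ENNReal.ofReal (f t) ≤ g t)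
    (hg : ∫⁻ t in Ici (0 : ℝ), g t ≠ ⊤) {T : ℝ} (hT : 0 ≤ T) :
    ∫ t in (0 : ℝ)..T, f t ≤ (∫⁻ t in Ici (0 : ℝ), g t).toReal := by
  have hsub : Ioc 0 T ⊆ Ici (0 : ℝ) := fun t ht => ht.1.le
  have hint : IntegrableOn f (Ioc 0 T) :=
    (hf.mono Icc_subset_Ici_self).integrableOn_Icc.mono_set Ioc_subset_Icc_self
  rw [intervalIntegral.integral_of_le hT, integral_eq_lintegral_pos_part_sub_lintegral_neg_part hint]
  have hle : ∫⁻ t in Ioc 0 T, ENNReal.ofReal (f t) ≤ ∫⁻ t in Ici (0 : ℝ), g t :=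
    (setLIntegral_mono' measurableSet_Ioc fun t ht => hfg t (hsub ht)).trans
      (lintegral_mono_set hsub)
  linarith [ENNReal.toReal_mono hg hle,
    ENNReal.toReal_nonneg (a := ∫⁻ t in Ioc 0 T, ENNReal.ofReal (-f t))]

theorem stmt7 {H : Type*} [NormedAddCommGroup H] [InnerProductSpace ℝ H] [CompleteSpace H]
    (φ ψ : H → ℝ) (γ k : ℝ) (β β' : ℝ → ℝ) (x x' x'' : ℝ → H)
    -- ψ is convex, Fréchet differentiable with Lipschitz continuous gradient,
    -- nonnegative, and argmin ψ = ψ⁻¹(0) is nonempty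
    (hψconv : ConvexOn ℝ univ ψ)
    (hψdiff : Differentiable ℝ ψ)
    (hψlip : ∃ L : NNReal, LipschitzWith L (gradient ψ))
    (hψnonneg : ∀ y, 0 ≤ ψ y)
    (hψmin : ∃ y, ψ y = 0)
    -- φ is convex, Fréchet differentiable with Lipschitz continuous gradient,
    -- bounded from below, and S = {z ∈ argmin ψ : φ z ≤ φ y ∀ y ∈ argmin ψ} is nonempty
    (hφconv : ConvexOn ℝ univ φ)
    (hφdiff : Differentiable ℝ φ)
    (hφlip : ∃ L : NNReal, LipschitzWith L (gradient φ))
    (hφbdd : BddBelow (range φ))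
    (hS : ∃ z : H, ψ z = 0 ∧ ∀ y, ψ y = 0 → φ z ≤ φ y)
    -- γ > 0, 0 ≤ k < γ, and β : [0,∞) → (0,∞) is a C¹ function (with derivative β')
    -- satisfying the growth condition 0 ≤ β' ≤ k β
    (hγ : 0 < γ) (hk : 0 ≤ k) (hkγ : k < γ)
    (hβpos : ∀ t ∈ Ici (0 : ℝ), 0 < β t)
    (hβderiv : ∀ t ∈ Ici (0 : ℝ), HasDerivWithinAt β (β' t) (Ici 0) t)
    (hβ'cont : ContinuousOn β' (Ici 0))
    (hβgrowth : ∀ t ∈ Ici (0 : ℝ), 0 ≤ β' t ∧ β' t ≤ k * β t)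
    -- condition (H): for every p in the range of the normal cone to argmin ψ (i.e.
    -- p ∈ N(z) for some z ∈ argmin ψ = ψ⁻¹(0)), the integral
    -- ∫_0^∞ β(t) [ψ*(p/β(t)) - σ(p/β(t))] dt is finite; here σ(p/β(t)) = ⟪p/β(t), z⟫
    -- since p ∈ N(z), and β(t)[ψ*(q) - ⟪q, z⟫] = ⨆ w, β(t)((⟪q, w⟫ - ψ w) - ⟪q, z⟫) ≥ 0.
    (hH : ∀ z p : H, ψ z = 0 → (∀ y, ψ y = 0 → ⟪p, y - z⟫ ≤ 0) →
      ∫⁻ t in Ici (0 : ℝ), ⨆ w : H,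
        ENNReal.ofReal (β t * ((⟪(β t)⁻¹ • p, w⟫ - ψ w) - ⟪(β t)⁻¹ • p, z⟫)) ≠ ⊤)
    -- x : [0,∞) → H is twice continuously differentiable (first derivative x',
    -- second derivative x'') and satisfies ẍ + γ ẋ + ∇φ(x) + β ∇ψ(x) = 0 on [0,∞)
    (hx' : ∀ t ∈ Ici (0 : ℝ), HasDerivWithinAt x (x' t) (Ici 0) t)
    (hx'' : ∀ t ∈ Ici (0 : ℝ), HasDerivWithinAt x' (x'' t) (Ici 0) t)
    (hx''cont : ContinuousOn x'' (Ici 0))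
    (hode : ∀ t ∈ Ici (0 : ℝ),
      x'' t + γ • x' t + gradient φ (x t) + β t • gradient ψ (x t) = 0) :
    IntegrableOn (fun t => ‖x' t‖ ^ 2) (Ici 0) := by
  obtain ⟨z, hz, hzmin⟩ := hS
  obtain ⟨m, hm⟩ := hφbdd
  have hgk : 0 < γ + k := by linarith
  obtain ⟨a, ha, haγ, hak⟩ : ∃ a : ℝ, 0 < a ∧ 1 < a * γ ∧ a * k < 1 :=
    ⟨2 / (γ + k), by positivity, by rw [div_mul_eq_mul_div, lt_div_iff₀ hgk]; linarith,
      by rw [div_mul_eq_mul_div, div_lt_one hgk]; linarith⟩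
  set ε : ℝ := 1 - a * k with hε
  have hεpos : 0 < ε := by linarith
  set c : ℝ := a * γ - 1 with hc
  have hcpos : 0 < c := by linarith
  set q : H := ε⁻¹ • -gradient φ z with hq
  have hqinner (w : H) : ε * ⟪q, w⟫ = -⟪gradient φ z, w⟫ := by
    rw [hq, real_inner_smul_left, inner_neg_left, mul_inv_cancel_left₀ hεpos.ne']
  have hCconv : Convex ℝ {y | ψ y = 0} := by
    convert hψconv.convex_le 0 using 1
    ext y
    simpa using ⟨fun h => h.le, fun h => le_antisymm h (hψnonneg y)⟩
  have hqN (y : H) (hy : ψ y = 0) : ⟪q, y - z⟫ ≤ 0 := by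
    have h1 : IsMinOn φ {y | ψ y = 0} z := fun y hy => hzmin y hy
    have h2 := h1.inner_gradient_nonneg hCconv (hφdiff z) hz hy
    have h3 := hqinner (y - z)
    by_contra! h4
    nlinarith [mul_pos hεpos h4]
  have hxc : ContinuousOn x (Ici 0) := fun t ht => (hx' t ht).continuousWithinAt
  have hx'c : ContinuousOn x' (Ici 0) := fun t ht => (hx'' t ht).continuousWithinAt
  have hβc : ContinuousOn β (Ici 0) := fun t ht => (hβderiv t ht).continuousWithinAt
  set f : ℝ → ℝ := fun t => ⟪q, x t - z⟫ - β t * ψ (x t) with hf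
  have hfc : ContinuousOn f (Ici 0) :=
    (continuousOn_const.inner (hxc.sub continuousOn_const)).sub
      (hβc.mul (hψdiff.continuous.comp_continuousOn hxc))
  have hfH (t : ℝ) (ht : t ∈ Ici (0 : ℝ)) : ENNReal.ofReal (f t) ≤ ⨆ w : H,
      ENNReal.ofReal (β t * ((⟪(β t)⁻¹ • q, w⟫ - ψ w) - ⟪(β t)⁻¹ • q, z⟫)) := by
    refine le_iSup_of_le (x t) (ENNReal.ofReal_le_ofReal (le_of_eq ?_))
    have := (hβpos t ht).ne'
    simp only [hf, real_inner_smul_left, inner_sub_right]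
    field_simp
    ring
  have hbound (T : ℝ) (hT : 0 ≤ T) := intervalIntegral_le_toReal_lintegral hfc hfH (hH z q hz hqN) hT
  set M : ℝ := (∫⁻ t in Ici (0 : ℝ), ⨆ w : H,
    ENNReal.ofReal (β t * ((⟪(β t)⁻¹ • q, w⟫ - ψ w) - ⟪(β t)⁻¹ • q, z⟫))).toReal
  set F : ℝ → ℝ := fun t => a * (1 / 2 * ⟪x' t, x' t⟫ + φ (x t) + β t * ψ (x t))
    + ⟪x' t, x t - z⟫ + γ / 2 * ⟪x t - z, x t - z⟫ with hF
  have hFlow (t : ℝ) (ht : t ∈ Ici (0 : ℝ)) : a * m ≤ F t := by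
    have h1 : m ≤ φ (x t) := hm (mem_range_self _)
    have h2 : 0 ≤ β t * ψ (x t) := mul_nonneg (hβpos t ht).le (hψnonneg _)
    have h3 : 0 ≤ ⟪a • x' t + (x t - z), a • x' t + (x t - z)⟫ := real_inner_self_nonneg
    have h4 : 0 ≤ ⟪x t - z, x t - z⟫ := real_inner_self_nonneg
    simp only [inner_add_left, inner_add_right, real_inner_smul_left,
      real_inner_smul_right, real_inner_comm (x' t) (x t - z)] at h3
    have h5 : a * m ≤ a * (φ (x t) + β t * ψ (x t)) := mul_le_mul_of_nonneg_left (by linarith) ha.le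
    have h6 : 0 ≤ a * (a / 2 * ⟪x' t, x' t⟫ + ⟪x' t, x t - z⟫ + γ / 2 * ⟪x t - z, x t - z⟫) := by
      nlinarith [mul_nonneg hcpos.le h4]
    have h7 := nonneg_of_mul_nonneg_right h6 ha
    simp only [hF]
    linarith
  have hFderiv (t : ℝ) (ht : t ∈ Ici (0 : ℝ)) : HasDerivWithinAt F
      (a * (-γ * ⟪x' t, x' t⟫ + β' t * ψ (x t)) + ⟪x' t, x' t⟫
        - ⟪gradient φ (x t), x t - z⟫ - β t * ⟪gradient ψ (x t), x t - z⟫) (Ici 0) t := by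
    have h1 := hx'' t ht
    have h2 := (hx' t ht).sub_const z
    have h3 := (hφdiff (x t)).hasGradientAt.comp_hasDerivWithinAt (hx' t ht)
    have h4 := (hψdiff (x t)).hasGradientAt.comp_hasDerivWithinAt (hx' t ht)
    have h5 := (((((h1.inner ℝ h1).const_mul (1 / 2)).add h3).add
      ((hβderiv t ht).mul h4)).const_mul a).add (h1.inner ℝ h2) |>.add
      ((h2.inner ℝ h2).const_mul (γ / 2))
    refine h5.congr_deriv ?_
    have h6 : x'' t = -(γ • x' t) - gradient φ (x t) - β t • gradient ψ (x t) := by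
      rw [← sub_eq_zero, ← hode t ht]; abel
    have h7 : ⟪x' t, x'' t⟫ = ⟪x'' t, x' t⟫ := real_inner_comm _ _
    have h8 : ⟪x t - z, x' t⟫ = ⟪x' t, x t - z⟫ := real_inner_comm _ _
    rw [h7, h8, h6]
    simp only [inner_sub_left _ (β t • gradient ψ (x t)), inner_sub_left _ (gradient φ (x t)),
      inner_neg_left, real_inner_smul_left]
    ring
  have hFle (t : ℝ) (ht : t ∈ Ici (0 : ℝ)) :
      a * (-γ * ⟪x' t, x' t⟫ + β' t * ψ (x t)) + ⟪x' t, x' t⟫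
        - ⟪gradient φ (x t), x t - z⟫ - β t * ⟪gradient ψ (x t), x t - z⟫
      ≤ ε * f t - c * ‖x' t‖ ^ 2 := by
    have h1 := hφconv.add_inner_gradient_le hφdiff (x t) z
    have h2 := hφconv.add_inner_gradient_le hφdiff z (x t)
    have h3 := hψconv.add_inner_gradient_le hψdiff (x t) z
    rw [← neg_sub (x t) z, inner_neg_right] at h1 h3
    rw [hz] at h3
    have h4 : β t * ψ (x t) ≤ β t * ⟪gradient ψ (x t), x t - z⟫ :=
      mul_le_mul_of_nonneg_left (by linarith) (hβpos t ht).le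
    have h5 : a * (β' t * ψ (x t)) ≤ a * (k * β t * ψ (x t)) :=
      mul_le_mul_of_nonneg_left
        (mul_le_mul_of_nonneg_right (hβgrowth t ht).2 (hψnonneg _)) ha.le
    have h6 := hqinner (x t - z)
    have h7 : ε * f t = -⟪gradient φ z, x t - z⟫ - (1 - a * k) * (β t * ψ (x t)) := by
      rw [← h6, ← hε]; simp only [hf]; ring
    rw [h7, ← real_inner_self_eq_norm_sq, hc]
    linarith
  have hnc : ContinuousOn (fun t => ‖x' t‖ ^ 2) (Ici 0) := hx'c.norm.pow 2
  have hbd (T : ℝ) (hT : 0 ≤ T) :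
      ∫ t in (0 : ℝ)..T, ‖‖x' t‖ ^ 2‖ ≤ (F 0 - a * m + ε * M) / c := by
    have hsub : Icc 0 T ⊆ Ici (0 : ℝ) := Icc_subset_Ici_self
    have hfi : IntervalIntegrable f volume 0 T :=
      (hfc.mono hsub).intervalIntegrable_of_Icc hT
    have hni : IntervalIntegrable (fun t => ‖x' t‖ ^ 2) volume 0 T :=
      (hnc.mono hsub).intervalIntegrable_of_Icc hT
    have h1 := intervalIntegral.sub_le_integral_of_hasDeriv_right_of_le
      (φ := fun t => ε * f t - c * ‖x' t‖ ^ 2) hT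
      (fun t ht => (hFderiv t (hsub ht)).continuousWithinAt.mono hsub)
      (fun t ht => (hFderiv t ht.1.le).mono fun s hs => (ht.1.trans hs).le)
      (((continuousOn_const.mul hfc).sub (continuousOn_const.mul hnc)).mono hsub).integrableOn_Icc
      (fun t ht => hFle t ht.1.le)
    rw [intervalIntegral.integral_sub (hfi.const_mul ε) (hni.const_mul c),
      intervalIntegral.integral_const_mul, intervalIntegral.integral_const_mul] at h1
    simp only [norm_pow, norm_norm]
    rw [le_div_iff₀ hcpos]
    linarith [mul_le_mul_of_nonneg_left (hbound T hT) hεpos.le, hFlow T hT]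
  rw [integrableOn_Ici_iff_integrableOn_Ioi]
  refine integrableOn_Ioi_of_intervalIntegral_norm_bounded ((F 0 - a * m + ε * M) / c) 0
    (fun T => ?_) tendsto_id ((eventually_ge_atTop 0).mono hbd)
  exact (hnc.mono Icc_subset_Ici_self).integrableOn_Icc.mono_set Ioc_subset_Icc_self
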